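/- Let d ≥ 2. There exists p_0 < 1 such that for every p ∈ [p_0, 1], Q-almost surely on the event {|C| = +∞}, for all sufficiently large n the largest connected component L_n of the open subgraph inside B_n coincides with C_n, the connected component of 0 in C ∩ B_n. -/

import Mathlib

open MeasureTheory
open scoped ENNReal

namespace Perco

/-- Vertices of the lattice `Z^d`. -/
abbrev Zd (d : ℕ) := Fin d → ℤ

/-- A percolation configuration: each (unordered) edge of the lattice is open or closed.
(Only the values on nearest-neighbour pairs matter.) -/
abbrev Config (d : ℕ) := Sym2 (Zd d) → Bool

/-- Lattice adjacency: `(x,y) ∈ E^d`. -/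
def latAdj {d : ℕ} (x y : Zd d) : Prop := (∑ i, |x i - y i|) = 1

/-- Open adjacency in the configuration `ω`. -/
def openAdj {d : ℕ} (ω : Config d) (x y : Zd d) : Prop :=
  latAdj x y ∧ ω s(x, y) = true

/-- `C`: the open cluster of the origin. -/
def cluster {d : ℕ} (ω : Config d) : Set (Zd d) :=
  {y | Relation.ReflTransGen (openAdj ω) 0 y}

/-- `Q` is the product measure making the edge states i.i.d. Bernoulli(p). -/
def IsBernoulli {d : ℕ} (p : ℝ) (Q : Measure (Config d)) : Prop :=
  IsProbabilityMeasure Q ∧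
    ∀ (s : Finset (Sym2 (Zd d))) (f : Sym2 (Zd d) → Bool),
      Q {ω : Config d | ∀ e ∈ s, ω e = f e} =
        ∏ e ∈ s, (if f e then ENNReal.ofReal p else ENNReal.ofReal (1 - p))

/-- The critical probability `p_c`. -/
noncomputable def pc (d : ℕ) : ℝ :=
  sSup {p : ℝ | 0 ≤ p ∧ p ≤ 1 ∧
    ∀ Q : Measure (Config d), IsBernoulli p Q → Q {ω | (cluster ω).Infinite} = 0}

/-- The box `B_n = [-n,n]^d`. -/
def box (d n : ℕ) : Set (Zd d) := {x | ∀ i, |x i| ≤ (n : ℤ)}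

/-- `C_n`: the connected component of `0` in `C ∩ B_n`. -/
def clusterN {d : ℕ} (ω : Config d) (n : ℕ) : Set (Zd d) :=
  {y | Relation.ReflTransGen
    (fun a b => openAdj ω a b ∧ a ∈ box d n ∧ b ∈ box d n) 0 y}

/-- `A` is connected in the open subgraph. -/
def ConnOpen {d : ℕ} (ω : Config d) (A : Set (Zd d)) : Prop :=
  ∀ x ∈ A, ∀ y ∈ A,
    Relation.ReflTransGen (fun a b => openAdj ω a b ∧ a ∈ A ∧ b ∈ A) x y

/-- `A` is connected in the lattice. -/
def ConnLat {d : ℕ} (A : Set (Zd d)) : Prop :=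
  ∀ x ∈ A, ∀ y ∈ A,
    Relation.ReflTransGen (fun a b => latAdj a b ∧ a ∈ A ∧ b ∈ A) x y

/-- The boundary `∂_{C^g} A` = open lattice edges from `A` to its complement. -/
def bdry {d : ℕ} (ω : Config d) (A : Set (Zd d)) : Set (Zd d × Zd d) :=
  {e | openAdj ω e.1 e.2 ∧ e.1 ∈ A ∧ e.2 ∉ A}

/-- The profile `f_c` (at scale `n`, exponent `γ`). -/
noncomputable def fcut (d : ℕ) (γ c : ℝ) (n : ℕ) (x : ℝ) : ℝ :=
  if x < c * (n : ℝ) ^ γ then 1 else x ^ (1 - 1 / (d : ℝ))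

/-- `ν(x)`: number of open neighbours of `x`. -/
noncomputable def nu {d : ℕ} (ω : Config d) (x : Zd d) : ℕ :=
  Set.ncard {y | openAdj ω x y}

-- Transition kernel of the simple random walk on the open subgraph.
open Classical in
noncomputable def step {d : ℕ} (ω : Config d) (x y : Zd d) : ℝ :=
  if openAdj ω x y then ((nu ω x : ℝ))⁻¹ else 0

/-- Weight of a path of length `n`. -/
noncomputable def pathW {d n : ℕ} (ω : Config d) (γ : Fin (n + 1) → Zd d) : ℝ :=
  ∏ i : Fin n, step ω (γ i.castSucc) (γ i.succ)

/-- `N_n`: number of distinct sites visited by the path. -/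
noncomputable def visits {d n : ℕ} (γ : Fin (n + 1) → Zd d) : ℕ :=
  (Set.range γ).ncard

/-- `P_0^ω(E)`, the probability of a path event for the walk started at 0. -/
noncomputable def PWalk {d : ℕ} (ω : Config d) (n : ℕ)
    (E : (Fin (n + 1) → Zd d) → Prop) : ℝ :=
  ∑' γ : Fin (n + 1) → Zd d,
    Set.indicator {γ | γ 0 = 0 ∧ E γ} (fun γ => pathW ω γ) γ

/-- `E_0^ω(α^{N_n})`. -/
noncomputable def LaplaceN {d : ℕ} (ω : Config d) (α : ℝ) (n : ℕ) : ℝ :=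
  ∑' γ : Fin (n + 1) → Zd d,
    Set.indicator {γ | γ 0 = 0} (fun γ => pathW ω γ * α ^ visits γ) γ

/-- `E_0^ω(α^{N_n} 1_{X_n = 0})`. -/
noncomputable def LaplaceNReturn {d : ℕ} (ω : Config d) (α : ℝ) (n : ℕ) : ℝ :=
  ∑' γ : Fin (n + 1) → Zd d,
    Set.indicator {γ | γ 0 = 0 ∧ γ (Fin.last n) = 0}
      (fun γ => pathW ω γ * α ^ visits γ) γ

/-- Vertices of the wreath product `C^g ≀ Z/2Z` (lamplighter states). -/
abbrev Lamp (d : ℕ) := Zd d × (Zd d →₀ ZMod 2)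

/-- Flip a lamp configuration at one point. -/
noncomputable def flipAt {σ : Type*} (f : σ →₀ ZMod 2) (x : σ) : σ →₀ ZMod 2 :=
  f + Finsupp.single x 1

/-- Transition kernel of the lamplighter walk `Z` with parameter `α`. -/
noncomputable def ptilde {d : ℕ} (ω : Config d) (α : ℝ) (u v : Lamp d) : ℝ :=
  Set.indicator
    {q : Lamp d × Lamp d | ∀ x, x ≠ q.1.1 → x ≠ q.2.1 → q.1.2 x = q.2.2 x}
    (fun q => (if q.2.2 q.1.1 = 0 then α else 1 - α) *
      (if q.2.2 q.2.1 = 0 then α else 1 - α) * step ω q.1.1 q.2.1) (u, v)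

/-- `P̃_o^ω(Z_n = o)`: return probability of the lamplighter walk. -/
noncomputable def ZReturn {d : ℕ} (ω : Config d) (α : ℝ) (n : ℕ) : ℝ :=
  ∑' γ : Fin (n + 1) → Lamp d,
    Set.indicator {γ | γ 0 = (0, 0) ∧ γ (Fin.last n) = (0, 0)}
      (fun γ => ∏ i : Fin n, ptilde ω α (γ i.castSucc) (γ i.succ)) γ

/-- Vertex set of the wreath product over a vertex set `V` of the base. -/
def wVert {d : ℕ} (V : Set (Zd d)) : Set (Lamp d) :=
  {u | u.1 ∈ V ∧ ↑u.2.support ⊆ V}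

/-- Adjacency in the wreath product `C^g ≀ Z/2Z`. -/
def wAdj {d : ℕ} (ω : Config d) (u v : Lamp d) : Prop :=
  (u.1 = v.1 ∧ (∀ x, x ≠ u.1 → u.2 x = v.2 x) ∧ u.2 u.1 ≠ v.2 u.1) ∨
    (u.2 = v.2 ∧ openAdj ω u.1 v.1)

/-- Boundary of `U` in the wreath product `C^g ≀ Z/2Z`. -/
def wBdry {d : ℕ} (ω : Config d) (U : Set (Lamp d)) : Set (Lamp d × Lamp d) :=
  {e | e.1 ∈ U ∧ e.2 ∈ wVert (cluster ω) \ U ∧ wAdj ω e.1 e.2}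

/-- Følner function `Fol_{C_n^g}^{C^g}` (with value `⊤` when no set qualifies). -/
noncomputable def FolC {d : ℕ} (ω : Config d) (n : ℕ) (k : ℝ) : ℝ≥0∞ :=
  sInf {m : ℝ≥0∞ | ∃ A : Set (Zd d), A ⊆ clusterN ω n ∧ A.Nonempty ∧
    ((bdry ω A).ncard : ℝ) / (A.ncard : ℝ) ≤ 1 / k ∧ m = (A.ncard : ℝ≥0∞)}

/-- Følner function `Fol_{C_n^g ≀ Z/2Z}^{C^g ≀ Z/2Z}`. -/
noncomputable def FolW {d : ℕ} (ω : Config d) (n : ℕ) (k : ℝ) : ℝ≥0∞ :=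
  sInf {m : ℝ≥0∞ | ∃ U : Set (Lamp d), U ⊆ wVert (clusterN ω n) ∧ U.Nonempty ∧
    ((wBdry ω U).ncard : ℝ) / (U.ncard : ℝ) ≤ 1 / k ∧ m = (U.ncard : ℝ≥0∞)}

/-- Degree of a configuration `f` in the graph `K_U`. -/
noncomputable def Kdeg {d : ℕ} (U : Set (Lamp d)) (f : Zd d →₀ ZMod 2) : ℕ :=
  Set.ncard {g : Zd d →₀ ZMod 2 | ∃ x : Zd d, (x, f) ∈ U ∧ (x, g) ∈ U ∧ g = flipAt f x}

/-- A point `u = (x,f)` of `U` is bad if `(x, f̄_x) ∉ U`. -/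
def badPt {d : ℕ} (U : Set (Lamp d)) (u : Lamp d) : Prop :=
  (u.1, flipAt u.2 u.1) ∉ U

/-- `D(0,x) ≤ r`: the chemical distance from the origin to `x` is at most `r`. -/
def chemLE {d : ℕ} (ω : Config d) (x : Zd d) (r : ℕ) : Prop :=
  ∃ m ≤ r, ∃ γ : ℕ → Zd d, γ 0 = 0 ∧ γ m = x ∧ ∀ i < m, openAdj ω (γ i) (γ (i + 1))

/-- `B_r(C)`: chemical ball of radius `r` around the origin. -/
def chemBall {d : ℕ} (ω : Config d) (r : ℕ) : Set (Zd d) := {x | chemLE ω x r}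

/-- Lattice connected component of `x` inside a vertex set `V`. -/
def latCompIn {d : ℕ} (V : Set (Zd d)) (x : Zd d) : Set (Zd d) :=
  {y | Relation.ReflTransGen (fun a b => latAdj a b ∧ a ∈ V ∧ b ∈ V) x y}

/-- Open connected component of `x` inside a vertex set `V`. -/
def openCompIn {d : ℕ} (ω : Config d) (V : Set (Zd d)) (x : Zd d) : Set (Zd d) :=
  {y | Relation.ReflTransGen (fun a b => openAdj ω a b ∧ a ∈ V ∧ b ∈ V) x y}

/-- `L_n`: a connected component of the open subgraph inside `B_n` of maximal cardinality. -/
def IsLargestComp {d : ℕ} (ω : Config d) (n : ℕ) (L : Set (Zd d)) : Prop :=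
  (∃ x ∈ box d n, L = openCompIn ω (box d n) x) ∧
    ∀ y ∈ box d n, (openCompIn ω (box d n) y).ncard ≤ L.ncard

/-- `\bar L`: the connected component of `L` in the full open subgraph. -/
def closureOf {d : ℕ} (ω : Config d) (L : Set (Zd d)) : Set (Zd d) :=
  {y | ∃ x ∈ L, Relation.ReflTransGen (openAdj ω) x y}

/-- The boundary `∂_{\bar L_n^g} A`. -/
def bdryBar {d : ℕ} (ω : Config d) (n : ℕ) (L A : Set (Zd d)) : Set (Zd d × Zd d) :=
  {e | openAdj ω e.1 e.2 ∧ e.1 ∈ A ∩ closureOf ω L ∧ e.2 ∈ box d (n + 1) \ A}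

/-- `n(A)`: number of connected components of `B_n − L` containing a component of `A`. -/
noncomputable def nComp {d : ℕ} (n : ℕ) (L A : Set (Zd d)) : ℕ :=
  Set.ncard {P : Set (Zd d) |
    (∃ x ∈ box d n \ L, P = latCompIn (box d n \ L) x) ∧
    ∃ x ∈ A, latCompIn A x ⊆ P}

/-- The killed kernel `P^{B_r(C)}` acting on functions. -/
noncomputable def Pball {d : ℕ} (ω : Config d) (r : ℕ) (f : Zd d → ℝ) : Zd d → ℝ :=
  Set.indicator (chemBall ω r) (fun x =>
    ∑' y : Zd d, Set.indicator (chemBall ω r) (fun y => step ω x y * f y) y)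

/-- The Dirichlet form `ξ(f,f) = ((Id − P^{B_r(C)}) 1_{B_r(C)} f | f)_ν`. -/
noncomputable def dirichletForm {d : ℕ} (ω : Config d) (r : ℕ) (f : Zd d → ℝ) : ℝ :=
  ∑' x : Zd d, (nu ω x : ℝ) * f x *
    (Set.indicator (chemBall ω r) f x - Pball ω r (Set.indicator (chemBall ω r) f) x)

/-- `‖f‖²_{l²(ν)}`. -/
noncomputable def normSq {d : ℕ} (ω : Config d) (f : Zd d → ℝ) : ℝ :=
  ∑' x : Zd d, (nu ω x : ℝ) * f x ^ 2

/-- `λ_1(B_r(C))`: smallest Dirichlet eigenvalue of the killed walk. -/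
noncomputable def lambda1 {d : ℕ} (ω : Config d) (r : ℕ) : ℝ :=
  sInf {t : ℝ | ∃ f : Zd d → ℝ, f ≠ 0 ∧ Function.support f ⊆ chemBall ω r ∧
    t = dirichletForm ω r f / normSq ω f}

/-- The `i`-th standard basis vector of `Z^d`. -/
def basisVec {d : ℕ} (i : Fin d) : Zd d := Pi.single i 1

lemma basisVec_same {d : ℕ} (i : Fin d) : basisVec i i = 1 := by simp [basisVec]

lemma basisVec_ne {d : ℕ} {i k : Fin d} (h : k ≠ i) : basisVec i k = 0 := by
  simp [basisVec, h]

lemma latAdj_symm {d : ℕ} {x y : Zd d} (h : latAdj x y) : latAdj y x := by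
  unfold latAdj at *
  simpa only [abs_sub_comm] using h

lemma openAdj_symm {d : ℕ} {ω : Config d} {x y : Zd d} (h : openAdj ω x y) : openAdj ω y x :=
  ⟨latAdj_symm h.1, by rw [Sym2.eq_swap]; exact h.2⟩

lemma latAdj_add_basisVec {d : ℕ} (x : Zd d) (i : Fin d) : latAdj x (x + basisVec i) := by
  unfold latAdj
  rw [Finset.sum_eq_single i]
  · simp [basisVec_same]
  · intro k _ hk
    simp [basisVec_ne hk]
  · simp

lemma exists_basisVec_of_latAdj {d : ℕ} {x y : Zd d} (h : latAdj x y) :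
    ∃ i, y = x + basisVec i ∨ x = y + basisVec i := by
  unfold latAdj at h
  obtain ⟨i, hi⟩ : ∃ i, x i ≠ y i := by
    by_contra! hne
    simp [hne] at h
  have hsplit := Finset.add_sum_erase Finset.univ (fun i => |x i - y i|) (Finset.mem_univ i)
  simp only [h] at hsplit
  have hpos : 1 ≤ |x i - y i| := Int.one_le_abs (sub_ne_zero.2 hi)
  have hnn : 0 ≤ ∑ k ∈ Finset.univ.erase i, |x k - y k| :=
    Finset.sum_nonneg fun _ _ => abs_nonneg _
  have hzero : ∑ k ∈ Finset.univ.erase i, |x k - y k| = 0 := by linarith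
  have hone : |x i - y i| = 1 := by linarith
  have hoff : ∀ k, k ≠ i → x k = y k := fun k hk => by
    have := (Finset.sum_eq_zero_iff_of_nonneg fun _ _ => abs_nonneg _).1 hzero k (by simp [hk])
    rwa [abs_eq_zero, sub_eq_zero] at this
  refine ⟨i, ?_⟩
  rcases (abs_eq (by norm_num)).1 hone with h1 | h1
  · right
    funext k
    by_cases hk : k = i
    · subst hk; simp [basisVec_same]; linarith
    · simp [basisVec_ne hk, hoff k hk]
  · left
    funext k
    by_cases hk : k = i
    · subst hk; simp [basisVec_same]; linarith
    · simp [basisVec_ne hk, hoff k hk]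

lemma abs_sub_le_one_of_latAdj {d : ℕ} {x y : Zd d} (h : latAdj x y) (i : Fin d) :
    |x i - y i| ≤ 1 := by
  rw [← h]
  exact Finset.single_le_sum (f := fun i => |x i - y i|) (fun _ _ => abs_nonneg _)
    (Finset.mem_univ i)

/-- A mod 2 cochain on the edges of the box which vanishes on the boundary of every plaquette
is a coboundary, as far as the directions in `s` are concerned. -/
lemma exists_potential {d n : ℕ} (c : Zd d → Fin d → ZMod 2)
    (hc : ∀ x i j, x ∈ box d n → x + basisVec i ∈ box d n → x + basisVec j ∈ box d n →
      x + basisVec i + basisVec j ∈ box d n →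
      c x i + c (x + basisVec i) j = c x j + c (x + basisVec j) i) (s : Finset (Fin d)) :
    ∃ φ : Zd d → ZMod 2, ∀ i ∈ s, ∀ x ∈ box d n, x + basisVec i ∈ box d n →
      φ (x + basisVec i) = φ x + c x i := by
  induction s using Finset.induction_on with
  | empty => exact ⟨0, by simp⟩
  | insert k s hk ih =>
    obtain ⟨φ, hφ⟩ := ih
    set c' : Zd d → Fin d → ZMod 2 := fun x i => c x i - (φ (x + basisVec i) - φ x) with hc'
    have hinv : ∀ i ∈ s, ∀ x, x ∈ box d n → x + basisVec i ∈ box d n → x + basisVec k ∈ box d n →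
        x + basisVec i + basisVec k ∈ box d n → c' (x + basisVec i) k = c' x k := by
      intro i hi x h1 h2 h3 h4
      have h := hc x i k h1 h2 h3 h4
      have e1 := hφ i hi x h1 h2
      have h4' : x + basisVec k + basisVec i ∈ box d n := by rwa [add_right_comm]
      have e2 := hφ i hi _ h3 h4'
      rw [add_right_comm] at e2
      simp only [hc']
      rw [e1, e2]
      linear_combination h
    refine ⟨fun x => φ x + ∑ t ∈ Finset.Ico (-(n : ℤ)) (x k), c' (Function.update x k t) k, ?_⟩
    intro i hi x hx hxi
    by_cases hik : i = k
    · subst hik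
      have hu : ∀ t, Function.update (x + basisVec i) i t = Function.update x i t := by
        intro t
        funext l
        by_cases hl : l = i
        · subst hl; simp
        · simp [hl, basisVec_ne hl]
      have hlow : -(n : ℤ) ≤ x i := (abs_le.1 (hx i)).1
      simp only [hu, Pi.add_apply, basisVec_same]
      have hins : Finset.Ico (-(n : ℤ)) (x i + 1) = insert (x i) (Finset.Ico (-(n : ℤ)) (x i)) := by
        ext t; simp only [Finset.mem_Ico, Finset.mem_insert]; omega
      rw [hins, Finset.sum_insert (by simp), Function.update_eq_self]
      simp only [hc']
      ring
    · have his : i ∈ s := (Finset.mem_insert.1 hi).resolve_left hik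
      have hki : k ≠ i := fun h => hik h.symm
      have hu : ∀ t, Function.update (x + basisVec i) k t = Function.update x k t + basisVec i := by
        intro t
        funext l
        by_cases hl : l = k
        · subst hl; simp [basisVec_ne hki]
        · simp [hl]
      have hmem : ∀ y ∈ box d n, ∀ t, |t| ≤ (n : ℤ) → Function.update y k t ∈ box d n := by
        intro y hy t ht l
        by_cases hl : l = k
        · subst hl; simpa using ht
        · simpa [hl] using hy l
      have hadd : ∀ t, ∀ y : Zd d,
          Function.update y k t + basisVec k = Function.update y k (t + 1) := by
        intro t y
        funext l
        by_cases hl : l = k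
        · subst hl; simp [basisVec_same]
        · simp [hl, basisVec_ne hl]
      have hxk : (x + basisVec i) k = x k := by simp [basisVec_ne hki]
      have hb := abs_le.1 (hx k)
      simp only [hu, hxk]
      rw [hφ i his x hx hxi, Finset.sum_congr rfl (fun t ht => ?_)]
      · ring
      · rw [Finset.mem_Ico] at ht
        have ht1 : |t| ≤ (n : ℤ) := abs_le.2 ⟨ht.1, by omega⟩
        have ht2 : |t + 1| ≤ (n : ℤ) := abs_le.2 ⟨by omega, by omega⟩
        apply hinv i his _ (hmem x hx t ht1)
        · rw [← hu]; exact hmem _ hxi t ht1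
        · rw [hadd]; exact hmem x hx _ ht2
        · rw [← hu, hadd]; exact hmem _ hxi _ ht2

/-- The vertices at sup-distance at most `r` from `c`. -/
def supBall {d : ℕ} (c : Zd d) (r : ℕ) : Set (Zd d) := {x | ∀ i, |x i - c i| ≤ (r : ℤ)}

lemma supBall_eq_Icc {d : ℕ} (c : Zd d) (r : ℕ) :
    supBall c r = (Finset.Icc (fun i => c i - r) (fun i => c i + r) : Finset (Zd d)) := by
  ext x
  simp only [supBall, Set.mem_ofPred_eq, Finset.coe_Icc, Set.mem_Icc, Pi.le_def, abs_le,
    ← forall_and]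
  refine forall_congr' fun i => ?_
  constructor <;> rintro ⟨h1, h2⟩ <;> constructor <;> linarith

lemma card_Icc_ball {d : ℕ} (c : Zd d) (r : ℕ) :
    (Finset.Icc (fun i => c i - r) (fun i => c i + r) : Finset (Zd d)).card = (2 * r + 1) ^ d := by
  rw [Pi.card_Icc]
  simp only [Int.card_Icc]
  rw [Finset.prod_congr rfl (g := fun _ => 2 * r + 1) (fun i _ => by omega)]
  simp

lemma finite_supBall {d : ℕ} (c : Zd d) (r : ℕ) : (supBall c r).Finite := by
  rw [supBall_eq_Icc]; exact Finset.finite_toSet _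

lemma ncard_supBall {d : ℕ} (c : Zd d) (r : ℕ) : (supBall c r).ncard = (2 * r + 1) ^ d := by
  rw [supBall_eq_Icc, Set.ncard_coe_finset, card_Icc_ball]

lemma box_eq_supBall (d n : ℕ) : box d n = supBall 0 n := by
  simp [box, supBall]

lemma finite_box (d n : ℕ) : (box d n).Finite := by
  rw [box_eq_supBall]; exact finite_supBall _ _

/-- A function on the box which does not change along edges both of whose endpoints avoid a
smaller ball is constant outside that ball. -/
lemma eq_of_forall_edge_eq {α : Type*} {d n r : ℕ} (hd : 2 ≤ d) (hrn : r < n) (c : Zd d)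
    (f : Zd d → α)
    (hf : ∀ x i, x ∈ box d n → x + basisVec i ∈ box d n → x ∉ supBall c r →
      x + basisVec i ∉ supBall c r → f (x + basisVec i) = f x)
    {x y : Zd d} (hx : x ∈ box d n) (hy : y ∈ box d n) (hxc : x ∉ supBall c r)
    (hyc : y ∉ supBall c r) : f x = f y := by
  have hout : ∀ {z : Zd d} {i : Fin d}, (r : ℤ) < |z i - c i| → z ∉ supBall c r :=
    fun {z i} h hz => absurd (hz i) (not_le.2 h)
  have hmem : ∀ y ∈ box d n, ∀ k t, |t| ≤ (n : ℤ) → Function.update y k t ∈ box d n := by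
    intro y hy k t ht l
    by_cases hl : l = k
    · subst hl; simpa using ht
    · simpa [hl] using hy l
  have hstep : ∀ z ∈ box d n, ∀ k, (∃ i, i ≠ k ∧ (r : ℤ) < |z i - c i|) → ∀ t, |t| ≤ (n : ℤ) →
      f (Function.update z k t) = f (Function.update z k (-n)) := by
    intro z hz k ⟨i, hik, hi⟩ t ht
    have key : ∀ m : ℕ, -(n : ℤ) + m ≤ n →
        f (Function.update z k (-n + m)) = f (Function.update z k (-n)) := by
      intro m
      induction m with
      | zero => simp
      | succ m ih =>
        intro hm
        push_cast at hm ⊢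
        rw [← ih (by omega)]
        have e : Function.update z k (-(n : ℤ) + (m + 1)) =
            Function.update z k (-(n : ℤ) + m) + basisVec k := by
          funext l
          by_cases hl : l = k
          · subst hl; simp [basisVec_same]; ring
          · simp [hl, basisVec_ne hl]
        rw [e]
        apply hf
        · exact hmem z hz k _ (abs_le.2 ⟨by omega, by omega⟩)
        · rw [← e]; exact hmem z hz k _ (abs_le.2 ⟨by omega, by omega⟩)
        · exact hout (i := i) (by simpa [hik] using hi)
        · rw [← e]; exact hout (i := i) (by simpa [hik] using hi)
    rw [abs_le] at ht
    have := key (t + n).toNat (by omega)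
    rwa [show -(n : ℤ) + (t + n).toNat = t by omega] at this
  have hline : ∀ z ∈ box d n, ∀ k, (∃ i, i ≠ k ∧ (r : ℤ) < |z i - c i|) → ∀ t, |t| ≤ (n : ℤ) →
      f (Function.update z k t) = f z := by
    intro z hz k h t ht
    rw [hstep z hz k h t ht, ← hstep z hz k h (z k) (hz k), Function.update_eq_self]
  have hplane : ∀ i, ∀ x ∈ box d n, (r : ℤ) < |x i - c i| → ∀ y ∈ box d n, x i = y i →
      f x = f y := by
    intro i x hx hi y hy hxy
    have key : ∀ s : Finset (Fin d), i ∉ s → f (s.piecewise y x) = f x := by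
      intro s
      induction s using Finset.induction_on with
      | empty => simp
      | insert k s hk ih =>
        intro his
        rw [Finset.mem_insert, not_or] at his
        rw [Finset.piecewise_insert, hline, ih his.2]
        · intro l
          by_cases hl : l ∈ s
          · simpa [hl] using hy l
          · simpa [hl] using hx l
        · exact ⟨i, his.1, by simpa [his.2] using hi⟩
        · exact hy k
    have h := key (Finset.univ.erase i) (by simp)
    rw [← h]
    congr 1
    funext l
    by_cases hl : l = i
    · subst hl; simp [hxy]
    · simp [hl]
  have hcross : ∀ i j, i ≠ j → ∀ x ∈ box d n, ∀ y ∈ box d n, (r : ℤ) < |x i - c i| →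
      (r : ℤ) < |y j - c j| → f x = f y := by
    intro i j hij x hx y hy hi hj
    have h1 : f x = f (Function.update y i (x i)) :=
      hplane i x hx hi _ (hmem y hy i _ (hx i)) (by simp)
    rw [h1]
    exact hplane j _ (hmem y hy i _ (hx i)) (by simpa [hij.symm] using hj) y hy
      (by simp [hij.symm])
  simp only [supBall, Set.mem_ofPred_eq, not_forall, not_le] at hxc hyc
  obtain ⟨i, hi⟩ := hxc
  obtain ⟨j, hj⟩ := hyc
  by_cases hij : i = j
  · subst hij
    have : Nontrivial (Fin d) := Fin.nontrivial_iff_two_le.2 hd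
    obtain ⟨k, hk⟩ := exists_ne i
    obtain ⟨t, ht, htc⟩ : ∃ t : ℤ, |t| ≤ (n : ℤ) ∧ (r : ℤ) < |t - c k| := by
      rcases le_total 0 (c k) with h | h
      · refine ⟨-n, by simp, ?_⟩
        rw [abs_of_nonpos (by omega)]; omega
      · refine ⟨n, by simp, ?_⟩
        rw [abs_of_nonneg (by omega)]; omega
    rw [← hline x hx k ⟨i, hk.symm, hi⟩ t ht]
    exact hcross k i hk _ (hmem x hx k t ht) y hy (by simpa using htc) hj
  · exact hcross i j hij x hx y hy hi hj

/-- A vertex is bad if one of the edges leaving it in a positive direction is closed. -/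
def BadSite {d : ℕ} (ω : Config d) (x : Zd d) : Prop := ∃ i, ω s(x, x + basisVec i) = false

/-- The graph on bad vertices joining those at sup-distance `1`. -/
def badGraph {d : ℕ} (ω : Config d) : SimpleGraph (Zd d) where
  Adj x y := x ≠ y ∧ (∀ i, |x i - y i| ≤ 1) ∧ BadSite ω x ∧ BadSite ω y
  symm := ⟨fun _ _ h =>
    ⟨h.1.symm, fun i => by rw [abs_sub_comm]; exact h.2.1 i, h.2.2.2, h.2.2.1⟩⟩
  loopless := ⟨fun _ h => h.1 rfl⟩

lemma reachable_of_near {d : ℕ} {ω : Config d} {x y : Zd d} (h : ∀ i, |x i - y i| ≤ 1)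
    (hx : BadSite ω x) (hy : BadSite ω y) : (badGraph ω).Reachable x y := by
  by_cases hxy : x = y
  · subst hxy; exact SimpleGraph.Reachable.refl _
  · exact SimpleGraph.Adj.reachable ⟨hxy, h, hx, hy⟩

/-- The vertex lists of walks with `m` steps from `x`, each step of sup-length at most `1`. -/
noncomputable def starWalks {d : ℕ} : ℕ → Zd d → Finset (List (Zd d))
  | 0, x => {[x]}
  | m + 1, x => (Finset.Icc (fun i => x i - (1 : ℕ)) (fun i => x i + (1 : ℕ))).biUnion
      fun y => (starWalks m y).image (List.cons x)

lemma card_starWalks_le {d : ℕ} (m : ℕ) (x : Zd d) : (starWalks m x).card ≤ (3 ^ d) ^ m := by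
  induction m generalizing x with
  | zero => simp [starWalks]
  | succ m ih =>
    rw [starWalks, pow_succ']
    refine (Finset.card_biUnion_le_card_mul _ _ _
      fun y _ => Finset.card_image_le.trans (ih y)).trans ?_
    rw [card_Icc_ball]

lemma length_of_mem_starWalks {d m : ℕ} {x : Zd d} {l : List (Zd d)} (h : l ∈ starWalks m x) :
    l.length = m + 1 := by
  induction m generalizing x l with
  | zero => simp [starWalks] at h; simp [h]
  | succ m ih =>
    simp only [starWalks, Finset.mem_biUnion, Finset.mem_image] at h
    obtain ⟨y, -, l', hl', rfl⟩ := h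
    simp [ih hl']

lemma support_mem_starWalks {d : ℕ} {ω : Config d} {x y : Zd d} (p : (badGraph ω).Walk x y) :
    p.support ∈ starWalks p.length x := by
  induction p with
  | nil => simp [starWalks]
  | @cons u v w h p ih =>
    simp only [SimpleGraph.Walk.length_cons, SimpleGraph.Walk.support_cons, starWalks,
      Finset.mem_biUnion, Finset.mem_image]
    refine ⟨v, ?_, _, ih, rfl⟩
    rw [← Finset.mem_coe, ← supBall_eq_Icc]
    intro i
    rw [abs_sub_comm]
    exact_mod_cast h.2.1 i

lemma badSite_of_mem_support {d : ℕ} {ω : Config d} {x y : Zd d} (p : (badGraph ω).Walk x y)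
    (hx : BadSite ω x) : ∀ z ∈ p.support, BadSite ω z := by
  induction p with
  | nil => simpa using hx
  | cons h p ih => simpa [hx] using ih h.2.2.2

lemma abs_sub_le_length {d : ℕ} {ω : Config d} {x y : Zd d} (p : (badGraph ω).Walk x y)
    (i : Fin d) : |y i - x i| ≤ (p.length : ℤ) := by
  induction p with
  | nil => simp
  | @cons u v w h p ih =>
    have h1 := h.2.1 i
    rw [abs_sub_comm] at h1
    have := abs_sub_le (w i) (v i) (u i)
    simp only [SimpleGraph.Walk.length_cons]
    push_cast
    linarith

/-- No self-avoiding star-connected path of bad vertices with `r` steps starts in the box. -/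
def NoLongBadPath {d : ℕ} (ω : Config d) (n r : ℕ) : Prop :=
  ∀ x ∈ box d n, ∀ l ∈ starWalks r x, l.Nodup → ∃ y ∈ l, ¬ BadSite ω y

lemma NoLongBadPath.mem_supBall {d n r : ℕ} {ω : Config d} (h : NoLongBadPath ω n r) {x y : Zd d}
    (hx : x ∈ box d n) (hbad : BadSite ω x) (hxy : (badGraph ω).Reachable x y) :
    y ∈ supBall x r := by
  obtain ⟨p, hp⟩ := hxy.exists_isPath
  intro i
  refine (abs_sub_le_length p i).trans ?_
  by_contra! hlt
  have hlen : (p.take r).length = r := by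
    rw [SimpleGraph.Walk.take_length]; omega
  have hmem := support_mem_starWalks (p.take r)
  rw [hlen] at hmem
  obtain ⟨z, hz, hzb⟩ := h x hx _ hmem (hp.take r).support_nodup
  exact hzb (badSite_of_mem_support _ hbad z hz)

lemma mem_of_mem_openCompIn {d : ℕ} {ω : Config d} {V : Set (Zd d)} {x y : Zd d} (hx : x ∈ V)
    (h : y ∈ openCompIn ω V x) : y ∈ V := by
  induction h with
  | refl => exact hx
  | tail _ hab _ => exact hab.2.2

lemma openCompIn_symm {d : ℕ} {ω : Config d} {V : Set (Zd d)} {x y : Zd d}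
    (h : y ∈ openCompIn ω V x) : x ∈ openCompIn ω V y := by
  induction h with
  | refl => exact Relation.ReflTransGen.refl
  | tail _ hab ih =>
    exact Relation.ReflTransGen.head ⟨openAdj_symm hab.1, hab.2.2, hab.2.1⟩ ih

lemma openCompIn_eq_of_mem {d : ℕ} {ω : Config d} {V : Set (Zd d)} {x y : Zd d}
    (h : y ∈ openCompIn ω V x) : openCompIn ω V x = openCompIn ω V y := by
  ext z
  exact ⟨fun hz => Relation.ReflTransGen.trans (openCompIn_symm h) hz,
    fun hz => Relation.ReflTransGen.trans h hz⟩

/-- If bad vertices only form short paths, then of two distinct open components of the box at least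
one is small. -/
lemma NoLongBadPath.ncard_le {d n r : ℕ} (hd : 2 ≤ d) (hrn : r < n) {ω : Config d}
    (h : NoLongBadPath ω n r) {x₀ y₀ : Zd d} (hx₀ : x₀ ∈ box d n) (hy₀ : y₀ ∈ box d n)
    (hne : y₀ ∉ openCompIn ω (box d n) x₀) :
    (openCompIn ω (box d n) x₀).ncard ≤ (2 * r + 1) ^ d ∨
      (openCompIn ω (box d n) y₀).ncard ≤ (2 * r + 1) ^ d := by
  classical
  set L := openCompIn ω (box d n) x₀ with hL
  set M := openCompIn ω (box d n) y₀ with hM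
  set D := latCompIn (box d n \ L) y₀ with hD
  have hLbox : L ⊆ box d n := fun z hz => mem_of_mem_openCompIn hx₀ hz
  have hMbox : M ⊆ box d n := fun z hz => mem_of_mem_openCompIn hy₀ hz
  have hML : ∀ z ∈ M, z ∉ L := fun z hz hzL =>
    hne (Relation.ReflTransGen.trans hzL (openCompIn_symm hz))
  have hDout : ∀ z ∈ D, z ∈ box d n \ L := by
    intro z hz
    induction hz with
    | refl => exact ⟨hy₀, hne⟩
    | tail _ hab _ => exact hab.2.2
  have hMD : M ⊆ D := by
    intro z hz
    have hz' : Relation.ReflTransGen _ y₀ z := hz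
    induction hz' with
    | refl => exact Relation.ReflTransGen.refl
    | @tail a b hya hab ih =>
      exact Relation.ReflTransGen.tail (ih hya)
        ⟨hab.1.1, ⟨hab.2.1, hML a hya⟩, ⟨hab.2.2, hML b hz⟩⟩
  have hDstep : ∀ a ∈ D, ∀ b ∈ box d n, latAdj a b → b ∉ D → b ∈ L := by
    intro a ha b hb hab hbD
    by_contra hbL
    exact hbD (Relation.ReflTransGen.tail ha ⟨hab, hDout a ha, ⟨hb, hbL⟩⟩)
  let f : Zd d → ZMod 2 := fun z => if z ∈ D then 1 else 0
  have hfD : ∀ z ∈ D, f z = 1 := fun z hz => by simp [f, hz]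
  have hfL : ∀ z ∈ L, f z = 0 := fun z hz => by
    have : z ∉ D := fun hzD => (hDout z hzD).2 hz
    simp [f, this]
  have hends : ∀ x i, x ∈ box d n → x + basisVec i ∈ box d n → f (x + basisVec i) ≠ f x →
      (x ∈ D ∧ x + basisVec i ∈ L) ∨ (x ∈ L ∧ x + basisVec i ∈ D) := by
    intro x i hx hxi hf
    by_cases h1 : x ∈ D <;> by_cases h2 : x + basisVec i ∈ D
    · simp [f, h1, h2] at hf
    · exact Or.inl ⟨h1, hDstep x h1 _ hxi (latAdj_add_basisVec x i) h2⟩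
    · exact Or.inr ⟨hDstep _ h2 x hx (latAdj_symm (latAdj_add_basisVec x i)) h1, h2⟩
    · simp [f, h1, h2] at hf
  have hbad : ∀ x i, x ∈ box d n → x + basisVec i ∈ box d n → f (x + basisVec i) ≠ f x →
      BadSite ω x := by
    intro x i hx hxi hf
    refine ⟨i, ?_⟩
    by_contra hopen
    rw [Bool.not_eq_false] at hopen
    have hadj : openAdj ω x (x + basisVec i) := ⟨latAdj_add_basisVec x i, hopen⟩
    rcases hends x i hx hxi hf with ⟨h1, h2⟩ | ⟨h1, h2⟩
    · exact (hDout _ h1).2 (Relation.ReflTransGen.tail h2 ⟨openAdj_symm hadj, hxi, hx⟩)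
    · exact (hDout _ h2).2 (Relation.ReflTransGen.tail h1 ⟨hadj, hx, hxi⟩)
  obtain ⟨e, he⟩ : ∃ e : Zd d, ∀ x i, x ∈ box d n → x + basisVec i ∈ box d n →
      f (x + basisVec i) ≠ f x → x ∈ supBall e r := by
    by_cases hall : ∀ x i, x ∈ box d n → x + basisVec i ∈ box d n → f (x + basisVec i) = f x
    · exact ⟨0, fun x i hx hxi hf => absurd (hall x i hx hxi) hf⟩
    push Not at hall
    obtain ⟨e, j, he, hej, hfe⟩ := hall
    refine ⟨e, fun x i hx hxi hf => h.mem_supBall he (hbad e j he hej hfe) ?_⟩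
    let R : Zd d → Prop := fun x => (badGraph ω).Reachable e x
    let c : Zd d → Fin d → ZMod 2 := fun x i => if R x then f (x + basisVec i) - f x else 0
    have hc0 : ∀ x i, f (x + basisVec i) = f x → c x i = 0 := by
      intro x i hxi; simp [c, hxi]
    have hclosed : ∀ x i j, x ∈ box d n → x + basisVec i ∈ box d n → x + basisVec j ∈ box d n →
        x + basisVec i + basisVec j ∈ box d n →
        c x i + c (x + basisVec i) j = c x j + c (x + basisVec j) i := by
      intro x i j hx hxi hxj hxij
      have hcomm : x + basisVec j + basisVec i = x + basisVec i + basisVec j := add_right_comm _ _ _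
      have hnear : ∀ k l : Fin d, |basisVec k l| ≤ (1 : ℤ) ∧
          |basisVec k l - basisVec i l| ≤ (1 : ℤ) ∧
          |basisVec k l - basisVec j l| ≤ (1 : ℤ) := by
        intro k l
        simp only [basisVec, Pi.single_apply]
        refine ⟨?_, ?_, ?_⟩ <;> split_ifs <;> simp
      have hRR : ∀ u v : Zd d, (u = x ∨ u = x + basisVec i ∨ u = x + basisVec j) →
          (v = x ∨ v = x + basisVec i ∨ v = x + basisVec j) → BadSite ω u → BadSite ω v →
          R u → R v := by
        intro u v hu hv hbu hbv hRu
        refine hRu.trans (reachable_of_near (fun l => ?_) hbu hbv)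
        have hi := hnear i l
        have hj := hnear j l
        rcases hu with rfl | rfl | rfl <;> rcases hv with rfl | rfl | rfl <;>
          simp [hi, hj]
      by_cases hex : ∃ u k, (u = x ∨ u = x + basisVec i ∨ u = x + basisVec j) ∧ u ∈ box d n ∧
          u + basisVec k ∈ box d n ∧ f (u + basisVec k) ≠ f u ∧ R u
      · obtain ⟨u, k, hu, hub, hukb, hfu, hRu⟩ := hex
        have hc1 : ∀ v k, (v = x ∨ v = x + basisVec i ∨ v = x + basisVec j) → v ∈ box d n →
            v + basisVec k ∈ box d n → c v k = f (v + basisVec k) - f v := by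
          intro v k' hv hvb hvk
          by_cases hfv : f (v + basisVec k') = f v
          · rw [hc0 _ _ hfv, hfv, sub_self]
          · have : R v := hRR u v hu hv (hbad u k hub hukb hfu) (hbad v k' hvb hvk hfv) hRu
            simp [c, this]
        rw [hc1 x i (by simp) hx hxi, hc1 x j (by simp) hx hxj, hc1 _ j (by simp) hxi hxij,
          hc1 _ i (by simp) hxj (hcomm ▸ hxij), hcomm]
        ring
      · have hc1 : ∀ v k, (v = x ∨ v = x + basisVec i ∨ v = x + basisVec j) → v ∈ box d n →
            v + basisVec k ∈ box d n → c v k = 0 := by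
          intro v k' hv hvb hvk
          by_cases hfv : f (v + basisVec k') = f v
          · exact hc0 _ _ hfv
          · have : ¬ R v := fun hRv => hex ⟨v, k', hv, hvb, hvk, hfv, hRv⟩
            simp [c, this]
        rw [hc1 x i (by simp) hx hxi, hc1 x j (by simp) hx hxj, hc1 _ j (by simp) hxi hxij,
          hc1 _ i (by simp) hxj (hcomm ▸ hxij)]
    obtain ⟨φ, hφ⟩ := exists_potential c hclosed Finset.univ
    have hφ0 : ∀ a ∈ box d n, ∀ b ∈ box d n, latAdj a b → f a = f b → φ b = φ a := by
      intro a ha b hb hab hfab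
      obtain ⟨k, rfl | rfl⟩ := exists_basisVec_of_latAdj hab
      · rw [hφ k (by simp) a ha hb, hc0 a k hfab.symm, add_zero]
      · rw [hφ k (by simp) b hb ha, hc0 b k hfab, add_zero]
    have hφL : ∀ z ∈ L, φ z = φ x₀ := by
      intro z hz
      have hz' : Relation.ReflTransGen _ x₀ z := hz
      induction hz' with
      | refl => rfl
      | @tail a b hxa hab ih =>
        rw [← ih hxa]
        exact hφ0 a hab.2.1 b hab.2.2 hab.1.1 (by rw [hfL a hxa, hfL b hz])
    have hφD : ∀ z ∈ D, φ z = φ y₀ := by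
      intro z hz
      have hz' : Relation.ReflTransGen _ y₀ z := hz
      induction hz' with
      | refl => rfl
      | @tail a b hxa hab ih =>
        rw [← ih hxa]
        exact hφ0 a hab.2.1.1 b hab.2.2.1 hab.1 (by rw [hfD a hxa, hfD b hz])
    have hRe : R e := SimpleGraph.Reachable.refl _
    have hce : c e j ≠ 0 := by
      simp only [c, hRe, if_true]
      exact sub_ne_zero.2 hfe
    have hφe := hφ j (by simp) e he hej
    have hne' : φ x₀ ≠ φ y₀ := by
      intro heq
      apply hce
      rcases hends e j he hej hfe with ⟨h1, h2⟩ | ⟨h1, h2⟩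
      · rw [hφL _ h2, hφD _ h1, heq] at hφe
        simpa using hφe
      · rw [hφL _ h1, hφD _ h2, heq] at hφe
        simpa using hφe
    by_contra hRx
    have hcx : c x i = 0 := by
      have : ¬ R x := hRx
      simp [c, this]
    have hφx := hφ i (by simp) x hx hxi
    rw [hcx, add_zero] at hφx
    rcases hends x i hx hxi hf with ⟨h1, h2⟩ | ⟨h1, h2⟩
    · rw [hφL _ h2, hφD _ h1] at hφx
      exact hne' hφx
    · rw [hφL _ h1, hφD _ h2] at hφx
      exact hne' hφx.symm
  by_contra! hbig
  obtain ⟨hbL, hbM⟩ := hbig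
  have hout : ∀ A : Set (Zd d), (2 * r + 1) ^ d < A.ncard → ∃ z ∈ A, z ∉ supBall e r := by
    intro A hA
    by_contra! hsub
    have := Set.ncard_le_ncard (s := A) hsub (finite_supBall e r)
    rw [ncard_supBall] at this
    omega
  obtain ⟨u, huL, hu⟩ := hout L hbL
  obtain ⟨v, hvM, hv⟩ := hout M hbM
  have heq := eq_of_forall_edge_eq hd hrn e f
    (fun x i hx hxi hxe _ => by
      by_contra hf
      exact hxe (he x i hx hxi hf)) (hLbox huL) (hMbox hvM) hu hv
  rw [hfL u huL, hfD v (hMD hvM)] at heq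
  exact zero_ne_one heq

/-- The largest absolute value of a coordinate. -/
def supNorm {d : ℕ} (x : Zd d) : ℕ := Finset.univ.sup fun i => (x i).natAbs

lemma mem_box_iff_supNorm {d n : ℕ} {x : Zd d} : x ∈ box d n ↔ supNorm x ≤ n := by
  simp only [box, Set.mem_ofPred_eq, supNorm, Finset.sup_le_iff, Finset.mem_univ, true_imp_iff]
  refine forall_congr' fun i => ?_
  rw [← Int.natCast_natAbs, Nat.cast_le]

lemma supNorm_le_of_latAdj {d : ℕ} {x y : Zd d} (h : latAdj x y) :
    supNorm y ≤ supNorm x + 1 := by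
  refine Finset.sup_le fun i _ => ?_
  have h1 := abs_sub_le_one_of_latAdj h i
  have h2 : (x i).natAbs ≤ supNorm x :=
    Finset.le_sup (f := fun i => (x i).natAbs) (Finset.mem_univ i)
  rw [abs_le] at h1
  omega

/-- If the cluster of the origin is infinite, its component in the box has more than `n` vertices. -/
lemma lt_ncard_clusterN {d : ℕ} {ω : Config d} (hinf : (cluster ω).Infinite) (n : ℕ) :
    n < (clusterN ω n).ncard := by
  have hzero : (0 : Zd d) ∈ box d n := fun i => by simp
  obtain ⟨y, hy, hyb⟩ : ∃ y ∈ cluster ω, y ∉ box d n := by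
    by_contra! hsub
    exact hinf ((finite_box d n).subset hsub)
  have key : (∀ k ≤ n, ∃ z ∈ clusterN ω n, supNorm z = k) ∨
      (y ∈ clusterN ω n ∧ ∀ k ≤ supNorm y, ∃ z ∈ clusterN ω n, supNorm z = k) := by
    have hy' : Relation.ReflTransGen (openAdj ω) 0 y := hy
    clear hy hyb
    induction hy' with
    | refl =>
      refine Or.inr ⟨Relation.ReflTransGen.refl, fun k hk => ⟨0, Relation.ReflTransGen.refl, ?_⟩⟩
      have h0 : supNorm (0 : Zd d) ≤ 0 := Finset.sup_le fun i _ => by simp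
      omega
    | @tail a b _ hab ih =>
      rcases ih with ih | ⟨ha, ih⟩
      · exact Or.inl ih
      have hle := supNorm_le_of_latAdj hab.1
      have hab' : a ∈ box d n := mem_of_mem_openCompIn hzero ha
      by_cases hb : b ∈ box d n
      · have hbC : b ∈ clusterN ω n := Relation.ReflTransGen.tail ha ⟨hab, hab', hb⟩
        refine Or.inr ⟨hbC, fun k hk => ?_⟩
        by_cases hka : k ≤ supNorm a
        · exact ih k hka
        · exact ⟨b, hbC, by omega⟩
      · rw [mem_box_iff_supNorm] at hb
        exact Or.inl fun k hk => ih k (by omega)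
  have hsub : clusterN ω n ⊆ box d n := fun z hz => mem_of_mem_openCompIn hzero hz
  rcases key with key | ⟨h1, -⟩
  · have himg : (Finset.range (n + 1) : Set ℕ) ⊆ supNorm '' clusterN ω n := by
      intro k hk
      rw [Finset.mem_coe, Finset.mem_range] at hk
      exact key k (by omega)
    have hfin := (finite_box d n).subset hsub
    have := (Set.ncard_le_ncard himg (hfin.image _)).trans (Set.ncard_image_le hfin)
    rwa [Set.ncard_coe_finset, Finset.card_range] at this
  · exact absurd (hsub h1) hyb

lemma NoLongBadPath.eq_clusterN {d n r : ℕ} (hd : 2 ≤ d) (hrn : r < n)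
    (hr : (2 * r + 1) ^ d ≤ n) {ω : Config d} (h : NoLongBadPath ω n r)
    (hinf : (cluster ω).Infinite) {L : Set (Zd d)} (hL : IsLargestComp ω n L) :
    L = clusterN ω n := by
  obtain ⟨⟨x, hx, rfl⟩, hmax⟩ := hL
  have hzero : (0 : Zd d) ∈ box d n := fun i => by simp
  have hC : n < (openCompIn ω (box d n) 0).ncard := lt_ncard_clusterN hinf n
  by_cases h0 : (0 : Zd d) ∈ openCompIn ω (box d n) x
  · exact openCompIn_eq_of_mem h0
  · have := hmax 0 hzero
    rcases h.ncard_le hd hrn hx hzero h0 with h1 | h1 <;> omega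

lemma edge_injective {d : ℕ} {x y : Zd d} {i j : Fin d}
    (h : s(x, x + basisVec i) = s(y, y + basisVec j)) : x = y := by
  rw [Sym2.eq_iff] at h
  rcases h with ⟨h, -⟩ | ⟨h1, h2⟩
  · exact h
  · exfalso
    rw [h1, add_assoc] at h2
    have h3 := congrFun h2 i
    simp only [Pi.add_apply, basisVec_same] at h3
    have h4 : 0 ≤ basisVec j i := by
      simp only [basisVec, Pi.single_apply]; split_ifs <;> simp
    omega

lemma IsBernoulli.measure_forall_badSite_le {d : ℕ} {p : ℝ} {Q : Measure (Config d)}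
    (hQ : IsBernoulli p Q) (s : Finset (Zd d)) :
    Q {ω | ∀ y ∈ s, BadSite ω y} ≤ (d * ENNReal.ofReal (1 - p)) ^ s.card := by
  classical
  let E : (s → Fin d) → Finset (Sym2 (Zd d)) := fun f =>
    Finset.univ.image fun y : s => s((y : Zd d), (y : Zd d) + basisVec (f y))
  have hE : ∀ f, (E f).card = s.card := fun f => by
    rw [Finset.card_image_of_injective _ fun y z h => Subtype.ext (edge_injective h)]
    simp
  calc Q {ω | ∀ y ∈ s, BadSite ω y}
      ≤ Q (⋃ f : s → Fin d, {ω | ∀ e ∈ E f, ω e = false}) := by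
        refine measure_mono fun ω hω => ?_
        have hω' : ∀ y : s, ∃ i, ω s((y : Zd d), (y : Zd d) + basisVec i) = false :=
          fun y => hω y y.2
        choose f hf using hω'
        refine Set.mem_iUnion.2 ⟨f, fun e he => ?_⟩
        obtain ⟨y, -, rfl⟩ := Finset.mem_image.1 he
        exact hf y
    _ ≤ ∑ f : s → Fin d, Q {ω | ∀ e ∈ E f, ω e = false} := measure_iUnion_fintype_le _ _
    _ = ∑ _f : s → Fin d, ENNReal.ofReal (1 - p) ^ s.card := by
        refine Finset.sum_congr rfl fun f _ => ?_
        rw [hQ.2 (E f) fun _ => false]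
        simp [hE]
    _ = (d * ENNReal.ofReal (1 - p)) ^ s.card := by
        simp [mul_pow]

lemma IsBernoulli.measure_not_noLongBadPath_le {d : ℕ} {p : ℝ} {Q : Measure (Config d)}
    (hQ : IsBernoulli p Q) (hp : d * ENNReal.ofReal (1 - p) ≤ 1) (n r : ℕ) :
    Q {ω | ¬ NoLongBadPath ω n r} ≤
      (2 * n + 1 : ℕ) ^ d * (3 ^ d * (d * ENNReal.ofReal (1 - p))) ^ r := by
  classical
  set q := d * ENNReal.ofReal (1 - p) with hq
  let B : Finset (Zd d) := Finset.Icc (fun i => (0 : Zd d) i - n) (fun i => (0 : Zd d) i + n)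
  have hB : (B : Set (Zd d)) = box d n := by rw [box_eq_supBall, supBall_eq_Icc]
  have hBcard : B.card = (2 * n + 1) ^ d := card_Icc_ball _ _
  let W : Zd d → Finset (List (Zd d)) := fun x => (starWalks r x).filter List.Nodup
  calc Q {ω | ¬ NoLongBadPath ω n r}
      ≤ Q (⋃ x ∈ B, ⋃ l ∈ W x, {ω | ∀ y ∈ l.toFinset, BadSite ω y}) := by
        refine measure_mono fun ω hω => ?_
        simp only [NoLongBadPath, Set.mem_ofPred_eq] at hω
        push Not at hω
        obtain ⟨x, hx, l, hl, hnd, hbad⟩ := hω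
        rw [← hB, Finset.mem_coe] at hx
        refine Set.mem_biUnion hx (Set.mem_biUnion (Finset.mem_filter.2 ⟨hl, hnd⟩) ?_)
        exact fun y hy => hbad y (List.mem_toFinset.1 hy)
    _ ≤ ∑ x ∈ B, Q (⋃ l ∈ W x, {ω | ∀ y ∈ l.toFinset, BadSite ω y}) :=
        measure_biUnion_finset_le _ _
    _ ≤ ∑ _x ∈ B, (3 ^ d * q) ^ r := by
        refine Finset.sum_le_sum fun x _ => ?_
        calc Q (⋃ l ∈ W x, {ω | ∀ y ∈ l.toFinset, BadSite ω y})
            ≤ ∑ l ∈ W x, Q {ω | ∀ y ∈ l.toFinset, BadSite ω y} := measure_biUnion_finset_le _ _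
          _ ≤ ∑ _l ∈ W x, q ^ r := by
              refine Finset.sum_le_sum fun l hl => ?_
              obtain ⟨hl, hnd⟩ := Finset.mem_filter.1 hl
              refine (hQ.measure_forall_badSite_le _).trans ?_
              rw [List.toFinset_card_of_nodup hnd, length_of_mem_starWalks hl]
              exact pow_le_pow_right_of_le_one' hp (Nat.le_succ r)
          _ = (W x).card * q ^ r := by simp
          _ ≤ ((3 ^ d) ^ r : ℕ) * q ^ r := by
              gcongr
              exact (Finset.card_filter_le _ _).trans (card_starWalks_le r x)
          _ = (3 ^ d * q) ^ r := by push_cast; exact (mul_pow (3 ^ d) q r).symm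
    _ = (2 * n + 1 : ℕ) ^ d * (3 ^ d * q) ^ r := by
        rw [Finset.sum_const, hBcard, nsmul_eq_mul]; push_cast; rfl

lemma tendsto_clog_two_mul_add_one :
    Filter.Tendsto (fun n : ℕ => Nat.clog 2 (2 * n + 1)) Filter.atTop Filter.atTop := by
  refine Filter.tendsto_atTop.2 fun k => ?_
  filter_upwards [Filter.eventually_ge_atTop (2 ^ k)] with n hn
  by_contra! hlt
  have h1 := Nat.le_pow_clog (b := 2) (by norm_num) (2 * n + 1)
  have h2 := Nat.pow_le_pow_right (n := 2) (by norm_num) hlt.le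
  omega

/-- A polynomial in the logarithm of `n` is eventually at most `n`. -/
lemma eventually_pow_clog_le (a d : ℕ) :
    ∀ᶠ n : ℕ in Filter.atTop, (2 * (a * Nat.clog 2 (2 * n + 1)) + 1) ^ d ≤ n := by
  have hlim := (tendsto_pow_const_div_const_pow_of_one_lt d (r := (2 : ℝ)) (by norm_num))
  have hev : ∀ᶠ k : ℕ in Filter.atTop, (2 * (a * k) + 1) ^ d * 4 ≤ 2 ^ k := by
    have hC : (0 : ℝ) < 1 / (4 * (2 * a + 1) ^ d) := by positivity
    filter_upwards [hlim.eventually_le_const hC, Filter.eventually_ge_atTop 1] with k hk hk1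
    rw [div_le_div_iff₀ (by positivity) (by positivity), one_mul] at hk
    have hk' : k ^ d * (4 * (2 * a + 1) ^ d) ≤ 2 ^ k := by exact_mod_cast hk
    calc (2 * (a * k) + 1) ^ d * 4 ≤ ((2 * a + 1) * k) ^ d * 4 := by
          gcongr; nlinarith
      _ = k ^ d * (4 * (2 * a + 1) ^ d) := by rw [mul_pow]; ring
      _ ≤ 2 ^ k := hk'
  filter_upwards [tendsto_clog_two_mul_add_one.eventually hev,
    Filter.eventually_ge_atTop 1] with n hn hn1
  have hlt := Nat.pow_pred_clog_lt_self (b := 2) (by norm_num) (x := 2 * n + 1) (by omega)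
  have hpos : 0 < Nat.clog 2 (2 * n + 1) := Nat.clog_pos (by norm_num) (by omega)
  have hsucc : 2 ^ Nat.clog 2 (2 * n + 1) = 2 ^ (Nat.clog 2 (2 * n + 1)).pred * 2 := by
    rw [← pow_succ, Nat.pred_eq_sub_one, Nat.sub_add_cancel hpos]
  omega

lemma pow_mul_inv_two_pow_le (d n : ℕ) :
    ((2 * n + 1 : ℕ) : ℝ≥0∞) ^ d * (2⁻¹) ^ ((d + 2) * Nat.clog 2 (2 * n + 1)) ≤
      ENNReal.ofReal (1 / ((n + 1 : ℕ) : ℝ) ^ 2) := by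
  set k := Nat.clog 2 (2 * n + 1) with hk
  have h1 : ((2 * n + 1 : ℕ) : ℝ) ≤ 2 ^ k := by
    exact_mod_cast Nat.le_pow_clog (b := 2) (by norm_num) (2 * n + 1)
  have h2 : ((n + 1 : ℕ) : ℝ) ≤ (2 * n + 1 : ℕ) := by
    exact_mod_cast (by omega : n + 1 ≤ 2 * n + 1)
  have hconv : ((2 * n + 1 : ℕ) : ℝ≥0∞) ^ d * (2⁻¹) ^ ((d + 2) * k) =
      ENNReal.ofReal (((2 * n + 1 : ℕ) : ℝ) ^ d * (2⁻¹) ^ ((d + 2) * k)) := by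
    rw [ENNReal.ofReal_mul (by positivity), ENNReal.ofReal_pow (by positivity),
      ENNReal.ofReal_pow (by positivity), ENNReal.ofReal_natCast,
      ENNReal.ofReal_inv_of_pos (by norm_num), ENNReal.ofReal_ofNat]
  rw [hconv]
  refine ENNReal.ofReal_le_ofReal ?_
  rw [inv_pow, ← div_eq_mul_inv, div_le_div_iff₀ (by positivity) (by positivity), one_mul]
  calc ((2 * n + 1 : ℕ) : ℝ) ^ d * ((n + 1 : ℕ) : ℝ) ^ 2
      ≤ (2 ^ k) ^ d * (2 ^ k) ^ 2 := by gcongr; exact h2.trans h1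
    _ = 2 ^ ((d + 2) * k) := by ring

/-- for `p` close to 1, eventually `L_n = C_n`. -/
theorem stmt8 (d : ℕ) (hd : 2 ≤ d) :
    ∃ p0 < (1 : ℝ), ∀ p : ℝ, p0 ≤ p → p ≤ 1 →
      ∀ Q : Measure (Config d), IsBernoulli p Q →
        ∀ᵐ ω ∂Q, (cluster ω).Infinite →
          ∃ N : ℕ, ∀ n ≥ N, ∀ L : Set (Zd d),
            IsLargestComp ω n L → L = clusterN ω n := by
  have hd0 : (0 : ℝ) < d := by exact_mod_cast (by omega : 0 < d)
  refine ⟨1 - 1 / (2 * 3 ^ d * d), by linarith [show (0 : ℝ) < 1 / (2 * 3 ^ d * d) by positivity],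
    fun p hp _ Q hQ => ?_⟩
  have hq : (3 : ℝ≥0∞) ^ d * (d * ENNReal.ofReal (1 - p)) ≤ 2⁻¹ := by
    have hreal : (3 : ℝ) ^ d * (d * (1 / (2 * 3 ^ d * d))) = 2⁻¹ := by field_simp
    calc (3 : ℝ≥0∞) ^ d * (d * ENNReal.ofReal (1 - p))
        ≤ 3 ^ d * (d * ENNReal.ofReal (1 / (2 * 3 ^ d * d))) := by
          gcongr; linarith
      _ = ENNReal.ofReal (3 ^ d * (d * (1 / (2 * 3 ^ d * d)))) := by
          rw [ENNReal.ofReal_mul (by positivity), ENNReal.ofReal_mul (by positivity),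
            ENNReal.ofReal_pow (by positivity), ENNReal.ofReal_natCast, ENNReal.ofReal_ofNat]
      _ = 2⁻¹ := by
          rw [hreal, ENNReal.ofReal_inv_of_pos (by norm_num), ENNReal.ofReal_ofNat]
  have hq1 : d * ENNReal.ofReal (1 - p) ≤ 1 := by
    refine le_trans ?_ (hq.trans (by simp))
    exact le_mul_of_one_le_left' (one_le_pow₀ (by norm_num))
  let r : ℕ → ℕ := fun n => (d + 2) * Nat.clog 2 (2 * n + 1)
  have hsum : ∑' n, Q {ω | ¬ NoLongBadPath ω n (r n)} ≠ ⊤ := by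
    have hs : Summable fun n : ℕ => 1 / ((n + 1 : ℕ) : ℝ) ^ 2 :=
      (summable_nat_add_iff 1).2 (Real.summable_one_div_nat_pow.2 (by norm_num))
    refine ne_top_of_le_ne_top hs.tsum_ofReal_ne_top (ENNReal.tsum_le_tsum fun n => ?_)
    refine (hQ.measure_not_noLongBadPath_le hq1 n (r n)).trans ?_
    refine le_trans ?_ (pow_mul_inv_two_pow_le d n)
    gcongr
  filter_upwards [ae_eventually_notMem hsum] with ω hω hinf
  obtain ⟨N, hN⟩ := Filter.eventually_atTop.1 (hω.and (eventually_pow_clog_le (d + 2) d))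
  refine ⟨N, fun n hn L hL => ?_⟩
  obtain ⟨h1, h2⟩ := hN n hn
  have hlt : r n < n := by
    have h3 : 2 * r n + 1 ≤ (2 * r n + 1) ^ d := Nat.le_self_pow (by omega) _
    have h4 : (2 * r n + 1) ^ d ≤ n := h2
    omega
  exact NoLongBadPath.eq_clusterN hd hlt h2 (not_not.1 h1) hinf hL

end Perco
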